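/- Exponential decay of the ground state: let Q : ℝ³ → ℝ be the ground state, i.e. the unique positive radial smooth solution of −ΔQ + Q − Q² = 0 on ℝ³ vanishing at infinity with Q, ∇Q ∈ L²(ℝ³). Then for every n ∈ ℕ there exists a constant C_n > 0 such that for all p ∈ ℝ³, ‖D^n Q(p)‖ ≤ C_n e^{−|p|}, where D^n Q denotes the n-th total (Fréchet) derivative of Q. -/

import Mathlib

noncomputable section

open MeasureTheory Filter Real

/-- Partial derivative in the first spatial variable. -/
def pdx (f : ℝ → ℝ → ℝ → ℝ) (x y z : ℝ) : ℝ := deriv (fun a => f a y z) x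

/-- Partial derivative in the second spatial variable. -/
def pdy (f : ℝ → ℝ → ℝ → ℝ) (x y z : ℝ) : ℝ := deriv (fun b => f x b z) y

/-- Partial derivative in the third spatial variable. -/
def pdz (f : ℝ → ℝ → ℝ → ℝ) (x y z : ℝ) : ℝ := deriv (fun c => f x y c) z

/-- Spatial Laplacian Δf = f_xx + f_yy + f_zz of a function of three real variables. -/
def lap3 (f : ℝ → ℝ → ℝ → ℝ) (x y z : ℝ) : ℝ :=
  deriv (fun a => deriv (fun a' => f a' y z) a) x
    + deriv (fun b => deriv (fun b' => f x b' z) b) y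
    + deriv (fun c => deriv (fun c' => f x y c') c) z

/-- `u` solves the 3D Zakharov–Kuznetsov equation ∂ₜu + ∂ₓ(Δu + u²) = 0 pointwise. -/
def IsZKSolution (u : ℝ → ℝ → ℝ → ℝ → ℝ) : Prop :=
  ∀ t x y z : ℝ,
    deriv (fun s => u s x y z) t
      + deriv (fun a => lap3 (u t) a y z + (u t a y z) ^ 2) x = 0

/-- `t ↦ u(t,·)` is a smooth curve in the Schwartz space 𝒮(ℝ³): the function is jointly
smooth and every time derivative of every time slice is a Schwartz function. -/
def IsSchwartzCurve (u : ℝ → ℝ → ℝ → ℝ → ℝ) : Prop :=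
  ContDiff ℝ (⊤ : ℕ∞) (fun p : ℝ × ℝ × ℝ × ℝ => u p.1 p.2.1 p.2.2.1 p.2.2.2) ∧
    ∀ (n : ℕ) (t : ℝ), ∃ S : SchwartzMap (ℝ × ℝ × ℝ) ℝ,
      ∀ x y z : ℝ, S (x, y, z) = iteratedDeriv n (fun s => u s x y z) t

/-- `Q` is the ground state: a positive radial smooth solution of −ΔQ + Q − Q² = 0 on ℝ³,
vanishing at infinity, with Q and ∇Q square-integrable. -/
def IsGroundState (Q : ℝ → ℝ → ℝ → ℝ) : Prop :=
  ContDiff ℝ (⊤ : ℕ∞) (fun p : ℝ × ℝ × ℝ => Q p.1 p.2.1 p.2.2) ∧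
  (∀ x y z : ℝ, 0 < Q x y z) ∧
  (∃ q : ℝ → ℝ, ∀ x y z : ℝ, Q x y z = q (Real.sqrt (x ^ 2 + y ^ 2 + z ^ 2))) ∧
  Tendsto (fun p : ℝ × ℝ × ℝ => Q p.1 p.2.1 p.2.2) (cocompact (ℝ × ℝ × ℝ)) (nhds 0) ∧
  Integrable (fun p : ℝ × ℝ × ℝ => (Q p.1 p.2.1 p.2.2) ^ 2) ∧
  Integrable (fun p : ℝ × ℝ × ℝ =>
    (pdx Q p.1 p.2.1 p.2.2) ^ 2 + (pdy Q p.1 p.2.1 p.2.2) ^ 2 + (pdz Q p.1 p.2.1 p.2.2) ^ 2) ∧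
  (∀ x y z : ℝ, -(lap3 Q x y z) + Q x y z - (Q x y z) ^ 2 = 0)

open Set
open scoped ContDiff

/-- A function bounded above on `[R, ∞)` with `g' ≥ c g` there, `c > 0`, is nonpositive. -/
theorem nonpos_of_mul_le_deriv_of_bddAbove {g g' : ℝ → ℝ} {R c M : ℝ} (hc : 0 < c)
    (hg : ∀ r ≥ R, HasDerivAt g (g' r) r) (hle : ∀ r ≥ R, c * g r ≤ g' r)
    (hM : ∀ r ≥ R, g r ≤ M) : ∀ r ≥ R, g r ≤ 0 := by
  intro r₀ hr₀
  by_contra! hpos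
  have hd : ∀ r ≥ R, HasDerivAt (fun r => exp (-(c * r)) * g r)
      (exp (-(c * r)) * (g' r - c * g r)) r := by
    intro r hr
    have h1 : HasDerivAt (fun r : ℝ => -(c * r)) (-(c * 1)) r :=
      ((hasDerivAt_id r).const_mul c).neg
    exact (h1.exp.mul (hg r hr)).congr_deriv (by ring)
  have hmono : MonotoneOn (fun r => exp (-(c * r)) * g r) (Ici R) := by
    refine monotoneOn_of_hasDerivWithinAt_nonneg (convex_Ici R)
      (fun r hr => (hd r hr).continuousAt.continuousWithinAt)
      (fun r hr => (hd r (interior_subset hr)).hasDerivWithinAt) fun r hr => ?_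
    exact mul_nonneg (exp_pos _).le (sub_nonneg.2 (hle r (interior_subset hr)))
  have hM0 : 0 < M := hpos.trans_le (hM r₀ hr₀)
  set t : ℝ := M / (c * g r₀) with ht
  have ht0 : 0 < t := by positivity
  have hr : R ≤ r₀ + t := by linarith
  have h1 := hmono hr₀ hr (by linarith)
  have h2 : exp (c * t) * g r₀ ≤ g (r₀ + t) := by
    have h3 := mul_le_mul_of_nonneg_left h1 (exp_pos (c * (r₀ + t))).le
    simp only [← mul_assoc, ← exp_add] at h3
    rwa [add_neg_cancel, exp_zero, one_mul,
      show c * (r₀ + t) + -(c * r₀) = c * t by ring] at h3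
  have h4 : (c * t + 1) * g r₀ ≤ exp (c * t) * g r₀ :=
    mul_le_mul_of_nonneg_right (add_one_le_exp _) hpos.le
  have h5 : c * t * g r₀ = M := by rw [ht]; field_simp
  linarith [hM _ hr]

theorem antitoneOn_Ici_of_hasDerivAt {g g' : ℝ → ℝ} {R : ℝ}
    (hg : ∀ r ≥ R, HasDerivAt g (g' r) r) (h : ∀ r ≥ R, g' r ≤ 0) : AntitoneOn g (Ici R) :=
  antitoneOn_of_hasDerivWithinAt_nonpos (convex_Ici R)
    (fun r hr => (hg r hr).continuousAt.continuousWithinAt)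
    (fun r hr => (hg r (interior_subset hr)).hasDerivWithinAt)
    fun r hr => h r (interior_subset hr)

/-- Positive solutions of `w'' = (1 - φ) w` with `0 ≤ φ ≤ 3 / 4`, `φ ≤ w` and `w` sublinear
decay like `exp (-r)`, together with their derivative. -/
theorem exp_decay_of_schrodinger {w w₁ φ : ℝ → ℝ} {R : ℝ}
    (hw : ∀ r ≥ R, HasDerivAt w (w₁ r) r)
    (hw₁ : ∀ r ≥ R, HasDerivAt w₁ ((1 - φ r) * w r) r)
    (hpos : ∀ r ≥ R, 0 < w r) (hφ : ∀ r ≥ R, 0 ≤ φ r) (hφ' : ∀ r ≥ R, φ r ≤ 3 / 4)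
    (hφw : ∀ r ≥ R, φ r ≤ w r) (hlim : Tendsto (fun r => w r / r) atTop (nhds 0)) :
    ∃ C > 0, ∀ r ≥ R, w r ≤ C * exp (-r) ∧ |w₁ r| ≤ C * exp (-r) := by
  have hmono : MonotoneOn w₁ (Ici R) := by
    refine monotoneOn_of_hasDerivWithinAt_nonneg (convex_Ici R)
      (fun r hr => (hw₁ r hr).continuousAt.continuousWithinAt)
      (fun r hr => (hw₁ r (interior_subset hr)).hasDerivWithinAt) fun r hr => ?_
    have hr' : r ≥ R := interior_subset hr
    exact mul_nonneg (by linarith [hφ' r hr']) (hpos r hr').le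
  have hneg : ∀ r ≥ R, w₁ r ≤ 0 := by
    intro r₀ hr₀
    by_contra! h0
    have hlow : ∀ r ≥ r₀, w₁ r₀ * (r - r₀) ≤ w r := by
      intro r hr
      have hanti : AntitoneOn (fun r => w₁ r₀ * (r - r₀) - w r) (Ici r₀) := by
        refine antitoneOn_Ici_of_hasDerivAt (g' := fun r => w₁ r₀ * 1 - w₁ r) (fun s hs => ?_)
          fun s hs => ?_
        · exact (((hasDerivAt_id s).sub_const r₀).const_mul _).sub (hw s (hr₀.trans hs))
        · have := hmono hr₀ (hr₀.trans hs : R ≤ s) hs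
          simpa using this
      have := hanti self_mem_Ici hr hr
      simp only [sub_self, mul_zero] at this
      linarith [hpos r₀ hr₀]
    obtain ⟨r, hr, hr1, hr2⟩ := ((hlim.eventually (gt_mem_nhds (half_pos h0))).and
      ((eventually_ge_atTop r₀).and (eventually_gt_atTop (max 0 (2 * r₀))))).exists
    have hr3 : 0 < r := (le_max_left _ _).trans_lt hr2
    have hr4 : 2 * r₀ < r := (le_max_right _ _).trans_lt hr2
    rw [div_lt_iff₀ hr3] at hr
    nlinarith [hlow r hr1]
  have hanti : AntitoneOn w (Ici R) := antitoneOn_Ici_of_hasDerivAt hw hneg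
  have hwM : ∀ r ≥ R, w r ≤ w R := fun r hr => hanti self_mem_Ici hr hr
  have hhalf : ∀ r ≥ R, w₁ r + w r / 2 ≤ 0 := by
    refine nonpos_of_mul_le_deriv_of_bddAbove (c := 1 / 2) (M := w R / 2) (by norm_num)
      (fun r hr => (hw₁ r hr).add ((hw r hr).div_const 2)) (fun r hr => ?_) fun r hr => ?_
    · nlinarith [hφ' r hr, hpos r hr]
    · linarith [hneg r hr, hwM r hr]
  have hexp : ∀ (a r : ℝ), HasDerivAt (fun r : ℝ => exp (a * r)) (a * exp (a * r)) r := by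
    intro a r
    simpa [mul_comm] using ((hasDerivAt_id r).const_mul a).exp
  obtain ⟨K, hK0, hK⟩ : ∃ K > 0, ∀ r ≥ R, w r ≤ K * exp (-1 / 2 * r) := by
    have h : AntitoneOn (fun r => exp (1 / 2 * r) * w r) (Ici R) := by
      refine antitoneOn_Ici_of_hasDerivAt (fun r hr => (hexp _ r).mul (hw r hr)) fun r hr => ?_
      nlinarith [hhalf r hr, exp_pos (1 / 2 * r)]
    refine ⟨exp (1 / 2 * R) * w R, mul_pos (exp_pos _) (hpos R le_rfl), fun r hr => ?_⟩
    have := mul_le_mul_of_nonneg_right (h self_mem_Ici hr hr) (exp_pos (-1 / 2 * r)).le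
    have he : exp (1 / 2 * r) * exp (-1 / 2 * r) = 1 := by
      rw [← exp_add, ← exp_zero]; congr 1; ring
    calc w r = exp (1 / 2 * r) * w r * exp (-1 / 2 * r) := by
          rw [mul_right_comm, he, one_mul]
      _ ≤ _ := this
  have hupper : ∀ r ≥ R, w₁ r + w r - K * (exp (-1 / 2 * r) * w r) ≤ 0 := by
    refine nonpos_of_mul_le_deriv_of_bddAbove (c := 1) (M := w R) one_pos
      (fun r hr => ((hw₁ r hr).add (hw r hr)).sub
        (((hexp _ r).mul (hw r hr)).const_mul K)) (fun r hr => ?_) fun r hr => ?_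
    · have h1 : φ r * w r ≤ K * exp (-1 / 2 * r) * w r :=
        mul_le_mul_of_nonneg_right ((hφw r hr).trans (hK r hr)) (hpos r hr).le
      have h2 : 0 ≤ K * exp (-1 / 2 * r) * w r := by have := hpos r hr; positivity
      have h3 : 0 ≤ K * exp (-1 / 2 * r) * (-w₁ r) :=
        mul_nonneg (by positivity) (neg_nonneg.2 (hneg r hr))
      linarith
    · have h2 : 0 ≤ K * (exp (-1 / 2 * r) * w r) := by have := hpos r hr; positivity
      linarith [hneg r hr, hwM r hr]
  have hlower : ∀ r ≥ R, -(w₁ r + w r) ≤ 0 := by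
    refine nonpos_of_mul_le_deriv_of_bddAbove (c := 1) (M := -w₁ R) one_pos
      (fun r hr => ((hw₁ r hr).add (hw r hr)).neg) (fun r hr => ?_) fun r hr => ?_
    · linarith [mul_nonneg (hφ r hr) (hpos r hr).le]
    · linarith [hmono self_mem_Ici hr hr, hpos r hr]
  have hv : AntitoneOn (fun r => exp (r + 2 * K * exp (-1 / 2 * r)) * w r) (Ici R) := by
    refine antitoneOn_Ici_of_hasDerivAt (fun r hr => (((hasDerivAt_id r).add
      ((hexp (-1 / 2) r).const_mul (2 * K))).exp).mul (hw r hr)) fun r hr => ?_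
    have := mul_nonpos_of_nonneg_of_nonpos
      (exp_pos (r + 2 * K * exp (-1 / 2 * r))).le (hupper r hr)
    simp only [Pi.add_apply, id_eq]
    linarith
  set C := exp (R + 2 * K * exp (-1 / 2 * R)) * w R
  have hC : ∀ r ≥ R, w r ≤ C * exp (-r) := by
    intro r hr
    have h1 := hv self_mem_Ici hr hr
    have h2 : exp r * w r ≤ exp (r + 2 * K * exp (-1 / 2 * r)) * w r := by
      refine mul_le_mul_of_nonneg_right (exp_le_exp.2 ?_) (hpos r hr).le
      have : 0 ≤ 2 * K * exp (-1 / 2 * r) := by positivity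
      linarith
    have h3 := mul_le_mul_of_nonneg_right (h2.trans h1) (exp_pos (-r)).le
    rwa [mul_right_comm, ← exp_add, add_neg_cancel, exp_zero, one_mul] at h3
  refine ⟨C, mul_pos (exp_pos _) (hpos R le_rfl), fun r hr => ⟨hC r hr, ?_⟩⟩
  rw [abs_of_nonpos (hneg r hr)]
  linarith [hC r hr, hlower r hr]

section

variable {E F G : Type*} [NormedAddCommGroup E] [NormedSpace ℝ E]
  [NormedAddCommGroup F] [NormedSpace ℝ F] [NormedAddCommGroup G] [NormedSpace ℝ G]

theorem exists_bound_iteratedFDerivWithin_comp [ProperSpace F] {S : Set E} (hS : IsOpen S)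
    {u : E → F} {P : F → G} (hP : ContDiff ℝ ∞ P) (hu : ContDiffOn ℝ ∞ u S) {n : ℕ}
    (hb : ∀ i ≤ n, ∃ C, ∀ x ∈ S, ‖iteratedFDerivWithin ℝ i u S x‖ ≤ C) :
    ∃ C, ∀ x ∈ S, ‖iteratedFDerivWithin ℝ n (P ∘ u) S x‖ ≤ C := by
  choose! D hD using hb
  obtain ⟨C₀, hC₀⟩ : ∃ C, ∀ x ∈ S, ‖u x‖ ≤ C := ⟨D 0, fun x hx => by
    simpa using hD 0 (Nat.zero_le _) x hx⟩
  have hK : ∀ i : ℕ, ∃ K, ∀ y ∈ Metric.closedBall (0 : F) C₀, ‖iteratedFDeriv ℝ i P y‖ ≤ K :=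
    fun i => (isCompact_closedBall 0 C₀).exists_bound_of_continuousOn
      (hP.continuous_iteratedFDeriv (mod_cast le_top)).continuousOn
  choose K hK using hK
  set A := ∑ i ∈ Finset.range (n + 1), |K i|
  set B := 1 + ∑ i ∈ Finset.range (n + 1), |D i|
  have hsum : ∀ (f : ℕ → ℝ) (i : ℕ), i ≤ n → f i ≤ ∑ i ∈ Finset.range (n + 1), |f i| :=
    fun f i hi => (le_abs_self _).trans (Finset.single_le_sum (f := fun i => |f i|)
      (fun _ _ => abs_nonneg _) (Finset.mem_range.2 (Nat.lt_succ_of_le hi)))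
  refine ⟨n.factorial * A * B ^ n, fun x hx => ?_⟩
  refine norm_iteratedFDerivWithin_comp_le (t := univ) hP.contDiffOn hu (mod_cast le_top)
    uniqueDiffOn_univ hS.uniqueDiffOn (mapsTo_univ _ _) hx (fun i hi => ?_) fun i hi1 hi => ?_
  · rw [iteratedFDerivWithin_univ]
    exact (hK i _ (by simpa using hC₀ x hx)).trans (hsum K i hi)
  · have hB : 1 ≤ B := le_add_of_nonneg_right (Finset.sum_nonneg fun _ _ => abs_nonneg _)
    calc _ ≤ D i := hD i hi x hx
      _ ≤ B := (hsum D i hi).trans (by simp [B])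
      _ ≤ B ^ i := le_self_pow₀ hB (by omega)

theorem norm_iteratedFDerivWithin_succ_of_hasFDerivAt {S : Set E} (hS : IsOpen S)
    {u : E → F} {u' : E → E →L[ℝ] F} (hu : ∀ x ∈ S, HasFDerivAt u (u' x) x) (n : ℕ)
    {x : E} (hx : x ∈ S) :
    ‖iteratedFDerivWithin ℝ (n + 1) u S x‖ = ‖iteratedFDerivWithin ℝ n u' S x‖ := by
  rw [← norm_iteratedFDerivWithin_fderivWithin hS.uniqueDiffOn hx,
    iteratedFDerivWithin_congr (fun y hy => (fderivWithin_of_isOpen hS hy).trans (hu y hy).fderiv)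
      hx]

theorem contDiffOn_of_hasFDerivAt_comp {S : Set E} (hS : IsOpen S)
    {u : E → F} {P : F → E →L[ℝ] F} (hP : ContDiff ℝ ∞ P)
    (hu : ∀ x ∈ S, HasFDerivAt u (P (u x)) x) : ContDiffOn ℝ ∞ u S := by
  rw [contDiffOn_infty]
  intro n
  induction n with
  | zero => exact contDiffOn_zero.2 fun x hx => (hu x hx).continuousAt.continuousWithinAt
  | succ n ih =>
    push_cast
    rw [contDiffOn_succ_iff_fderiv_of_isOpen hS]
    refine ⟨fun x hx => (hu x hx).differentiableAt.differentiableWithinAt, by simp, ?_⟩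
    exact ((hP.of_le (mod_cast le_top)).comp_contDiffOn ih).congr fun x hx => (hu x hx).fderiv

/-- Bounded solutions of a smooth autonomous system `Du = P u` have bounded derivatives. -/
theorem exists_bound_iteratedFDerivWithin_of_hasFDerivAt_comp [ProperSpace F] {S : Set E}
    (hS : IsOpen S) {u : E → F} {P : F → E →L[ℝ] F} (hP : ContDiff ℝ ∞ P)
    (hu : ∀ x ∈ S, HasFDerivAt u (P (u x)) x) {C₀ : ℝ} (hb : ∀ x ∈ S, ‖u x‖ ≤ C₀) (n : ℕ) :
    ∃ C, ∀ x ∈ S, ‖iteratedFDerivWithin ℝ n u S x‖ ≤ C := by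
  induction n using Nat.strong_induction_on with
  | _ n ih =>
    cases n with
    | zero => exact ⟨C₀, by simpa using hb⟩
    | succ n =>
      obtain ⟨C, hC⟩ := exists_bound_iteratedFDerivWithin_comp hS hP
        (contDiffOn_of_hasFDerivAt_comp hS hP hu) fun i hi => ih i (Nat.lt_succ_of_le hi)
      refine ⟨C, fun x hx => ?_⟩
      rw [norm_iteratedFDerivWithin_succ_of_hasFDerivAt hS hu n hx]
      exact hC x hx

/-- Solutions of a linear system `DV = A V` whose coefficients have bounded derivatives inherit
on all derivatives any pointwise bound on `V`. -/
theorem exists_bound_iteratedFDerivWithin_of_linear {S : Set E} (hS : IsOpen S)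
    {A : E → G →L[ℝ] E →L[ℝ] G} {V : E → G} {ρ : E → ℝ}
    (hA : ContDiffOn ℝ ∞ A S) (hV : ContDiffOn ℝ ∞ V S)
    (hAb : ∀ n : ℕ, ∃ C, ∀ x ∈ S, ‖iteratedFDerivWithin ℝ n A S x‖ ≤ C)
    (hd : ∀ x ∈ S, HasFDerivAt V (A x (V x)) x) {C₀ : ℝ} (hb : ∀ x ∈ S, ‖V x‖ ≤ C₀ * ρ x)
    (n : ℕ) : ∃ C, ∀ x ∈ S, ‖iteratedFDerivWithin ℝ n V S x‖ ≤ C * ρ x := by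
  induction n using Nat.strong_induction_on with
  | _ n ih =>
    cases n with
    | zero => exact ⟨C₀, by simpa using hb⟩
    | succ n =>
      choose! D hD using ih
      choose K hK using hAb
      refine ⟨∑ i ∈ Finset.range (n + 1), n.choose i * |K i| * D (n - i), fun x hx => ?_⟩
      rw [norm_iteratedFDerivWithin_succ_of_hasFDerivAt hS hd n hx, Finset.sum_mul]
      refine (norm_iteratedFDerivWithin_clm_apply hA hV hS.uniqueDiffOn hx
        (mod_cast le_top)).trans (Finset.sum_le_sum fun i hi => ?_)
      rw [mul_assoc _ (D (n - i))]
      gcongr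
      · exact (hK i x hx).trans (le_abs_self _)
      · exact hD (n - i) (by omega) x hx

end

/-- The Euclidean norm of a point of `ℝ × ℝ × ℝ`. -/
def radius (p : ℝ × ℝ × ℝ) : ℝ := √(p.1 ^ 2 + p.2.1 ^ 2 + p.2.2 ^ 2)

/-- Euclidean inner product with a fixed vector of `ℝ × ℝ × ℝ`. -/
def dotCLM (e : ℝ × ℝ × ℝ) : (ℝ × ℝ × ℝ) →L[ℝ] ℝ :=
  e.1 • ContinuousLinearMap.fst ℝ ℝ (ℝ × ℝ)
    + e.2.1 • (ContinuousLinearMap.fst ℝ ℝ ℝ).comp (ContinuousLinearMap.snd ℝ ℝ (ℝ × ℝ))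
    + e.2.2 • (ContinuousLinearMap.snd ℝ ℝ ℝ).comp (ContinuousLinearMap.snd ℝ ℝ (ℝ × ℝ))

/-- Coefficients of the linear system satisfied by `(f (radius p), f' (radius p))`, as a function
of `(1 / radius p, p / radius p, f (radius p), f' (radius p))`. -/
def radialCoeff (u : ℝ × (ℝ × ℝ × ℝ) × ℝ × ℝ) :
    (ℝ × ℝ) →L[ℝ] (ℝ × ℝ × ℝ) →L[ℝ] (ℝ × ℝ) :=
  (ContinuousLinearMap.smulRightL ℝ (ℝ × ℝ × ℝ) (ℝ × ℝ) (dotCLM u.2.1)).comp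
    ((ContinuousLinearMap.snd ℝ ℝ ℝ).prod ((1 - u.2.2.1) • ContinuousLinearMap.fst ℝ ℝ ℝ
      - (2 * u.1) • ContinuousLinearMap.snd ℝ ℝ ℝ))

/-- Right-hand side of the autonomous system satisfied by
`(1 / radius p, p / radius p, f (radius p), f' (radius p))`. -/
def radialField (u : ℝ × (ℝ × ℝ × ℝ) × ℝ × ℝ) :
    (ℝ × ℝ × ℝ) →L[ℝ] (ℝ × (ℝ × ℝ × ℝ) × ℝ × ℝ) :=
  (-(u.1 ^ 2) • dotCLM u.2.1).prod
    ((u.1 • ContinuousLinearMap.id ℝ (ℝ × ℝ × ℝ)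
      - u.1 • (dotCLM u.2.1).smulRight u.2.1).prod (radialCoeff u u.2.2))

theorem contDiff_dotCLM : ContDiff ℝ ∞ dotCLM := by
  unfold dotCLM
  fun_prop

theorem contDiff_radialCoeff : ContDiff ℝ ∞ radialCoeff := by
  unfold radialCoeff
  have h1 : ContDiff ℝ ∞ fun u : ℝ × (ℝ × ℝ × ℝ) × ℝ × ℝ =>
      ContinuousLinearMap.smulRightL ℝ (ℝ × ℝ × ℝ) (ℝ × ℝ) (dotCLM u.2.1) :=
    (ContinuousLinearMap.contDiff _).comp (contDiff_dotCLM.comp (by fun_prop))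
  refine h1.clm_comp ?_
  have h2 : ContDiff ℝ ∞ fun u : ℝ × (ℝ × ℝ × ℝ) × ℝ × ℝ =>
      (1 - u.2.2.1) • ContinuousLinearMap.fst ℝ ℝ ℝ
        - (2 * u.1) • ContinuousLinearMap.snd ℝ ℝ ℝ := by
    fun_prop
  have h3 : ContDiff ℝ ∞ fun _ : ℝ × (ℝ × ℝ × ℝ) × ℝ × ℝ => ContinuousLinearMap.snd ℝ ℝ ℝ :=
    contDiff_const
  exact (ContinuousLinearMap.prodₗᵢ ℝ).contDiff.comp (h3.prodMk h2)

theorem contDiff_radialField : ContDiff ℝ ∞ radialField := by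
  have hdot : ContDiff ℝ ∞ fun u : ℝ × (ℝ × ℝ × ℝ) × ℝ × ℝ => dotCLM u.2.1 :=
    contDiff_dotCLM.comp (by fun_prop)
  have hcoeff := contDiff_radialCoeff
  have h3 : ContDiff ℝ ∞ fun u : ℝ × (ℝ × ℝ × ℝ) × ℝ × ℝ => radialCoeff u u.2.2 :=
    hcoeff.clm_apply (by fun_prop)
  have h2 : ContDiff ℝ ∞ fun u : ℝ × (ℝ × ℝ × ℝ) × ℝ × ℝ =>
      u.1 • ContinuousLinearMap.id ℝ (ℝ × ℝ × ℝ) - u.1 • (dotCLM u.2.1).smulRight u.2.1 := by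
    have : ContDiff ℝ ∞ fun u : ℝ × (ℝ × ℝ × ℝ) × ℝ × ℝ => (dotCLM u.2.1).smulRight u.2.1 :=
      hdot.smulRight (by fun_prop)
    fun_prop
  have h1 : ContDiff ℝ ∞ fun u : ℝ × (ℝ × ℝ × ℝ) × ℝ × ℝ => -(u.1 ^ 2) • dotCLM u.2.1 := by
    fun_prop
  exact (ContinuousLinearMap.prodₗᵢ ℝ).contDiff.comp (h1.prodMk
    ((ContinuousLinearMap.prodₗᵢ ℝ).contDiff.comp (h2.prodMk h3)))

theorem hasFDerivAt_radius {p : ℝ × ℝ × ℝ} (hp : 0 < radius p) :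
    HasFDerivAt radius (dotCLM ((radius p)⁻¹ • p)) p := by
  have h0 : p.1 ^ 2 + p.2.1 ^ 2 + p.2.2 ^ 2 ≠ 0 := (Real.sqrt_pos.1 hp).ne'
  have h1 : HasFDerivAt (fun p : ℝ × ℝ × ℝ => p.1) (ContinuousLinearMap.fst ℝ ℝ (ℝ × ℝ)) p :=
    hasFDerivAt_fst
  have h2 : HasFDerivAt (fun p : ℝ × ℝ × ℝ => p.2) (ContinuousLinearMap.snd ℝ ℝ (ℝ × ℝ)) p :=
    hasFDerivAt_snd
  have h := (((h1.pow 2).add (h2.fst.pow 2)).add (h2.snd.pow 2)).sqrt h0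
  refine h.congr_fderiv ?_
  change (1 / (2 * radius p)) • _ = _
  ext <;> simp [dotCLM] <;> field_simp

theorem norm_le_radius (p : ℝ × ℝ × ℝ) : ‖p‖ ≤ radius p := by
  refine max_le ?_ (max_le ?_ ?_) <;> refine Real.abs_le_sqrt ?_ <;>
    linarith [sq_nonneg p.1, sq_nonneg p.2.1, sq_nonneg p.2.2]

theorem norm_radius_inv_smul_le (p : ℝ × ℝ × ℝ) : ‖(radius p)⁻¹ • p‖ ≤ 1 := by
  have h : 0 ≤ radius p := Real.sqrt_nonneg _
  rw [norm_smul, norm_inv, Real.norm_of_nonneg h]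
  exact inv_mul_le_one_of_le₀ (norm_le_radius p) h

theorem hasFDerivAt_radialSystem {f f₁ : ℝ → ℝ} {p : ℝ × ℝ × ℝ} (hp : 0 < radius p)
    (hf : HasDerivAt f (f₁ (radius p)) (radius p))
    (hf₁ : HasDerivAt f₁ ((1 - f (radius p)) * f (radius p)
      - 2 * (radius p)⁻¹ * f₁ (radius p)) (radius p)) :
    HasFDerivAt (fun p => ((radius p)⁻¹, (radius p)⁻¹ • p, f (radius p), f₁ (radius p)))
      (radialField ((radius p)⁻¹, (radius p)⁻¹ • p, f (radius p), f₁ (radius p))) p := by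
  have hr := hasFDerivAt_radius hp
  have hi : HasFDerivAt (fun p => (radius p)⁻¹)
      (-((radius p)⁻¹ ^ 2) • dotCLM ((radius p)⁻¹ • p)) p := by
    exact ((hasDerivAt_inv hp.ne').comp_hasFDerivAt p hr).congr_fderiv (by rw [inv_pow])
  refine (hi.prodMk ((hi.smul (hasFDerivAt_id p)).prodMk
    ((hf.comp_hasFDerivAt p hr).prodMk (hf₁.comp_hasFDerivAt p hr)))).congr_fderiv ?_
  refine ContinuousLinearMap.ext fun v => ?_
  simp only [radialField, radialCoeff, ContinuousLinearMap.prod_apply, Prod.mk.injEq]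
  refine ⟨trivial, ?_, ?_⟩
  · simp [smul_smul, sub_eq_add_neg]
    congr 1
    ring
  · simp [mul_comm]

theorem deriv_deriv_comp_sqrt_sq_add_sq {f : ℝ → ℝ} (hf : ContDiff ℝ ∞ f) {r : ℝ} (hr : 0 < r) :
    deriv (fun b => deriv (fun c => f √(r ^ 2 + c ^ 2)) b) 0 = deriv f r / r := by
  have hpos : ∀ b : ℝ, 0 < r ^ 2 + b ^ 2 := fun b => by positivity
  have hdf := (contDiff_infty_iff_deriv.1 hf).1
  have hs : ∀ b : ℝ, HasDerivAt (fun c : ℝ => √(r ^ 2 + c ^ 2)) (b / √(r ^ 2 + b ^ 2)) b := by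
    intro b
    have h := (((hasDerivAt_id b).pow 2).const_add (r ^ 2)).sqrt (hpos b).ne'
    refine h.congr_deriv ?_
    simp only [id_eq, Pi.pow_apply]
    field_simp
    norm_num
  have h1 : (fun b => deriv (fun c => f √(r ^ 2 + c ^ 2)) b) =
      fun b => b * (deriv f √(r ^ 2 + b ^ 2) / √(r ^ 2 + b ^ 2)) := by
    funext b
    refine ((hdf _).hasDerivAt.comp b (hs b)).deriv.trans ?_
    ring
  have h2 : DifferentiableAt ℝ
      (fun b => deriv f √(r ^ 2 + b ^ 2) / √(r ^ 2 + b ^ 2)) 0 := by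
    have hd : Differentiable ℝ (deriv f) :=
      (contDiff_infty_iff_deriv.1 (contDiff_infty_iff_deriv.1 hf).2).1
    exact ((hd _).comp (0 : ℝ) (hs 0).differentiableAt).div (hs 0).differentiableAt
      (Real.sqrt_pos.2 (hpos 0)).ne'
  rw [h1]
  refine ((hasDerivAt_id (0 : ℝ)).mul h2.hasDerivAt).deriv.trans ?_
  simp [Real.sqrt_sq hr.le]

/-- The radial profile of a ground state solves `f'' + (2 / r) f' = f - f ^ 2`. -/
theorem IsGroundState.hasDerivAt_deriv_profile {Q : ℝ → ℝ → ℝ → ℝ} (hQ : IsGroundState Q)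
    (hf : ContDiff ℝ ∞ fun r => Q r 0 0)
    (hrad : ∀ x y z, Q x y z = Q √(x ^ 2 + y ^ 2 + z ^ 2) 0 0) {r : ℝ} (hr : 0 < r) :
    HasDerivAt (deriv fun r => Q r 0 0)
      ((1 - Q r 0 0) * Q r 0 0 - 2 * r⁻¹ * deriv (fun r => Q r 0 0) r) r := by
  have hd : Differentiable ℝ (deriv fun r => Q r 0 0) :=
    (contDiff_infty_iff_deriv.1 (contDiff_infty_iff_deriv.1 hf).2).1
  have hy : deriv (fun b => deriv (fun c => Q r c 0) b) 0 = deriv (fun r => Q r 0 0) r / r := by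
    rw [← deriv_deriv_comp_sqrt_sq_add_sq hf hr]
    congr 1
    funext b
    congr 1
    funext c
    rw [hrad r c 0]
    simp
  have hz : deriv (fun b => deriv (fun c => Q r 0 c) b) 0 = deriv (fun r => Q r 0 0) r / r := by
    rw [← deriv_deriv_comp_sqrt_sq_add_sq hf hr]
    congr 1
    funext b
    congr 1
    funext c
    rw [hrad r 0 c]
    simp
  have heq := hQ.2.2.2.2.2.2 r 0 0
  rw [lap3, hy, hz] at heq
  refine (hd r).hasDerivAt.congr_deriv ?_
  change deriv (fun a => deriv (fun a' => Q a' 0 0) a) r = _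
  rw [div_eq_mul_inv] at heq
  linarith

theorem IsGroundState.exists_profile_decay {Q : ℝ → ℝ → ℝ → ℝ} (hQ : IsGroundState Q)
    (hf : ContDiff ℝ ∞ fun r => Q r 0 0)
    (hrad : ∀ x y z, Q x y z = Q √(x ^ 2 + y ^ 2 + z ^ 2) 0 0) :
    ∃ R ≥ 1, ∃ C > 0, ∀ r ≥ R,
      |Q r 0 0| ≤ C * exp (-r) ∧ |deriv (fun r => Q r 0 0) r| ≤ C * exp (-r) := by
  set f : ℝ → ℝ := fun r => Q r 0 0 with hfdef
  have hfpos : ∀ r, 0 < f r := fun r => hQ.2.1 r 0 0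
  have hdf : Differentiable ℝ f := (contDiff_infty_iff_deriv.1 hf).1
  have hlim : Tendsto f atTop (nhds 0) := by
    have hemb : Topology.IsClosedEmbedding fun r : ℝ => (r, (0 : ℝ), (0 : ℝ)) :=
      .of_continuous_injective_isClosedMap (by fun_prop) (fun a b h => congrArg Prod.fst h)
        (isClosedMap_prodMk_right _)
    exact (hQ.2.2.2.1.comp hemb.tendsto_cocompact).mono_left atTop_le_cocompact
  obtain ⟨R₀, hR₀⟩ := eventually_atTop.1
    (hlim.eventually (ge_mem_nhds (by norm_num : (0 : ℝ) < 3 / 4)))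
  set R := max 1 R₀
  have hR1 : ∀ r ≥ R, 1 ≤ r := fun r hr => (le_max_left _ _).trans hr
  obtain ⟨C, hC0, hC⟩ := exp_decay_of_schrodinger (w := fun r => r * f r)
    (w₁ := fun r => f r + r * deriv f r) (φ := f) (R := R)
    (fun r _ => ((hasDerivAt_id r).mul (hdf r).hasDerivAt).congr_deriv (by simp))
    (fun r hr => by
      have hr0 : 0 < r := one_pos.trans_le (hR1 r hr)
      refine ((hdf r).hasDerivAt.add ((hasDerivAt_id r).mul
        (hQ.hasDerivAt_deriv_profile hf hrad hr0))).congr_deriv ?_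
      simp only [id_eq, hfdef]
      field_simp
      ring)
    (fun r hr => mul_pos (one_pos.trans_le (hR1 r hr)) (hfpos r)) (fun r _ => (hfpos r).le)
    (fun r hr => hR₀ r ((le_max_right _ _).trans hr))
    (fun r hr => le_mul_of_one_le_left (hfpos r).le (hR1 r hr))
    (hlim.congr' <| (eventually_gt_atTop 0).mono fun r hr => by field_simp)
  refine ⟨R, le_max_left _ _, 2 * C, by positivity, fun r hr => ?_⟩
  obtain ⟨h1, h2⟩ := hC r hr
  have hle : f r ≤ C * exp (-r) := (le_mul_of_one_le_left (hfpos r).le (hR1 r hr)).trans h1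
  have hexp : 0 ≤ C * exp (-r) := by positivity
  refine ⟨?_, ?_⟩
  · change |f r| ≤ _
    rw [abs_of_pos (hfpos r)]
    linarith
  · calc |deriv f r| ≤ r * |deriv f r| := le_mul_of_one_le_left (abs_nonneg _) (hR1 r hr)
      _ = |f r + r * deriv f r - f r| := by
        rw [add_sub_cancel_left, abs_mul, abs_of_pos (one_pos.trans_le (hR1 r hr))]
      _ ≤ |f r + r * deriv f r| + |f r| := abs_sub _ _
      _ ≤ 2 * C * exp (-r) := by rw [abs_of_pos (hfpos r)]; linarith

/-- A radial function whose profile solves the ground state equation and decays like `exp (-r)`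
together with its derivative has all derivatives bounded by `exp (-radius p)` far away. -/
theorem exists_bound_iteratedFDeriv_radial {f f₁ : ℝ → ℝ} {R C₀ : ℝ} (hR : 1 ≤ R)
    (hf : ∀ r > 0, HasDerivAt f (f₁ r) r)
    (hf₁ : ∀ r > 0, HasDerivAt f₁ ((1 - f r) * f r - 2 * r⁻¹ * f₁ r) r) (hC₀ : 0 < C₀)
    (hb : ∀ r ≥ R, |f r| ≤ C₀ * exp (-r) ∧ |f₁ r| ≤ C₀ * exp (-r)) (n : ℕ) :
    ∃ C, ∀ p, R < radius p →
      ‖iteratedFDeriv ℝ n (fun p => f (radius p)) p‖ ≤ C * exp (-radius p) := by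
  set S : Set (ℝ × ℝ × ℝ) := {p | R < radius p} with hSdef
  have hcont : Continuous radius := by unfold radius; fun_prop
  have hS : IsOpen S := isOpen_lt continuous_const hcont
  have hpos : ∀ p ∈ S, 0 < radius p := fun p hp => by
    have : R < radius p := hp
    linarith
  set u : ℝ × ℝ × ℝ → ℝ × (ℝ × ℝ × ℝ) × ℝ × ℝ :=
    fun p => ((radius p)⁻¹, (radius p)⁻¹ • p, f (radius p), f₁ (radius p)) with hudef
  have hu : ∀ p ∈ S, HasFDerivAt u (radialField (u p)) p := fun p hp =>
    hasFDerivAt_radialSystem (hpos p hp) (hf _ (hpos p hp)) (hf₁ _ (hpos p hp))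
  have hVb : ∀ p ∈ S, ‖(u p).2.2‖ ≤ C₀ * exp (-radius p) := fun p hp =>
    max_le (hb _ (le_of_lt hp)).1 (hb _ (le_of_lt hp)).2
  have hub : ∀ p ∈ S, ‖u p‖ ≤ 1 + C₀ := by
    intro p hp
    have h1 : C₀ * exp (-radius p) ≤ C₀ :=
      mul_le_of_le_one_right hC₀.le (exp_le_one_iff.2 (neg_nonpos.2 (hpos p hp).le))
    refine max_le ?_ (max_le ?_ ?_)
    · have hp' : R < radius p := hp
      change ‖(radius p)⁻¹‖ ≤ _
      rw [norm_inv, Real.norm_of_nonneg (hpos p hp).le]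
      have := inv_le_one_of_one_le₀ (hR.trans hp'.le)
      linarith
    · exact (norm_radius_inv_smul_le p).trans (by linarith)
    · exact (hVb p hp).trans (by linarith)
  have huS := contDiffOn_of_hasFDerivAt_comp hS contDiff_radialField hu
  have hder := exists_bound_iteratedFDerivWithin_of_hasFDerivAt_comp hS contDiff_radialField hu hub
  have hVS : ContDiffOn ℝ ∞ (fun p => (u p).2.2) S := huS.snd.snd
  obtain ⟨C, hC⟩ := exists_bound_iteratedFDerivWithin_of_linear hS
    (contDiff_radialCoeff.comp_contDiffOn huS) hVS
    (fun n => exists_bound_iteratedFDerivWithin_comp hS contDiff_radialCoeff huS fun i _ => hder i)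
    (fun p hp => (hu p hp).snd.snd) hVb n
  refine ⟨‖ContinuousLinearMap.fst ℝ ℝ ℝ‖ * C, fun p hp => ?_⟩
  rw [← iteratedFDerivWithin_of_isOpen n hS hp, mul_assoc]
  refine ((ContinuousLinearMap.fst ℝ ℝ ℝ).norm_iteratedFDerivWithin_comp_left
    (hVS p hp) hS.uniqueDiffOn hp (mod_cast le_top)).trans ?_
  gcongr
  exact hC p hp

/-- exponential decay of the ground state and all of its derivatives:
for every n there is C_n > 0 with ‖DⁿQ(p)‖ ≤ C_n e^{−|p|}. -/
theorem zk_ground_state_exponential_decay (Q : ℝ → ℝ → ℝ → ℝ) (hQ : IsGroundState Q)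
    (n : ℕ) :
    ∃ C > (0 : ℝ), ∀ x y z : ℝ,
      ‖iteratedFDeriv ℝ n (fun p : ℝ × ℝ × ℝ => Q p.1 p.2.1 p.2.2) (x, y, z)‖
        ≤ C * Real.exp (-Real.sqrt (x ^ 2 + y ^ 2 + z ^ 2)) := by
  have hsmooth := hQ.1
  have hf : ContDiff ℝ ∞ fun r => Q r 0 0 :=
    hsmooth.comp (f := fun r : ℝ => (r, (0 : ℝ), (0 : ℝ))) (by fun_prop)
  have hrad : ∀ x y z, Q x y z = Q √(x ^ 2 + y ^ 2 + z ^ 2) 0 0 := by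
    obtain ⟨q, hq⟩ := hQ.2.2.1
    intro x y z
    rw [hq, hq (√(x ^ 2 + y ^ 2 + z ^ 2))]
    simp
  obtain ⟨R, hR, C₀, hC₀, hb⟩ := hQ.exists_profile_decay hf hrad
  obtain ⟨C, hC⟩ := exists_bound_iteratedFDeriv_radial hR
    (fun r _ => ((contDiff_infty_iff_deriv.1 hf).1 r).hasDerivAt)
    (fun r hr => hQ.hasDerivAt_deriv_profile hf hrad hr) hC₀ hb n
  have hQrad : (fun p : ℝ × ℝ × ℝ => Q p.1 p.2.1 p.2.2) = fun p => Q (radius p) 0 0 :=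
    funext fun p => hrad _ _ _
  obtain ⟨K, hK⟩ := (isCompact_closedBall (0 : ℝ × ℝ × ℝ) R).exists_bound_of_continuousOn
    (hsmooth.continuous_iteratedFDeriv (m := n) (mod_cast le_top)).continuousOn
  refine ⟨max 1 (max C (K * exp R)), lt_max_of_lt_left one_pos, fun x y z => ?_⟩
  change _ ≤ _ * exp (-radius (x, y, z))
  rcases lt_or_ge R (radius (x, y, z)) with h | h
  · rw [hQrad]
    refine (hC _ h).trans (mul_le_mul_of_nonneg_right ?_ (exp_pos _).le)
    exact (le_max_left _ _).trans (le_max_right _ _)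
  · have hmem : (x, y, z) ∈ Metric.closedBall (0 : ℝ × ℝ × ℝ) R :=
      mem_closedBall_zero_iff.2 ((norm_le_radius _).trans h)
    have hK0 : 0 ≤ K := (norm_nonneg _).trans (hK _ hmem)
    calc _ ≤ K := hK _ hmem
      _ ≤ K * (exp R * exp (-radius (x, y, z))) := by
        refine le_mul_of_one_le_right hK0 ?_
        rw [← exp_add]
        exact one_le_exp (by linarith)
      _ = K * exp R * exp (-radius (x, y, z)) := by ring
      _ ≤ _ := mul_le_mul_of_nonneg_right
        ((le_max_right _ _).trans (le_max_right _ _)) (exp_pos _).le
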